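/- arXiv:1803.03108 — 6 statements merged into one kernel-verified Lean document; each statement's English description precedes it below -/
import Mathlib

section
/- Let α, β be real numbers with 0 < α < 2 and α/2 < β, and let E_{α,β}(u) = ∑_{r=0}^∞ u^r / Γ(α r + β). If the function x ↦ E_{α,β}(−x²) is Lebesgue integrable on ℝ, then ∫_{−∞}^{∞} E_{α,β}(−x²) dx = π / Γ(β − α/2). -/
open MeasureTheory

open Set Filter Topology in
/-- If the Laplace integral of `f` converges absolutely on the positive half-line, then it is
real-analytic there. -/
theorem analyticOnNhd_laplace {f : ℝ → ℝ}
    (hf : ∀ s : ℝ, 0 < s → IntegrableOn (fun t => Real.exp (-(s * t)) * f t) (Ioi 0)) :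
    AnalyticOnNhd ℝ (fun s : ℝ => ∫ t in Ioi (0 : ℝ), Real.exp (-(s * t)) * f t) (Ioi 0) := by
  have hmeas : AEMeasurable f (volume.restrict (Ioi (0 : ℝ))) := by
    have h1 : AEMeasurable (fun t => Real.exp t * (Real.exp (-(1 * t)) * f t))
        (volume.restrict (Ioi (0 : ℝ))) :=
      Real.measurable_exp.aemeasurable.mul (hf 1 one_pos).aemeasurable
    refine h1.congr (Eventually.of_forall fun t => ?_)
    simp only [← mul_assoc, ← Real.exp_add]
    simp
  have key : ∀ g : ℝ → ℝ, AEMeasurable g (volume.restrict (Ioi (0 : ℝ))) →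
      (∀ s : ℝ, 0 < s → IntegrableOn (fun t => Real.exp (-(s * t)) * g t) (Ioi 0)) →
      AnalyticOnNhd ℝ (fun s : ℝ => ∫ t in Ioi (0 : ℝ), Real.exp (-(s * t)) * max (g t) 0)
        (Ioi 0) := by
    intro g hg hgi
    set μ : Measure ℝ := (volume.restrict (Ioi (0 : ℝ))).withDensity
      (fun t => ((g t).toNNReal : ENNReal)) with hμ
    have hexp : ∀ s : ℝ, 0 < s → -s ∈ ProbabilityTheory.integrableExpSet id μ := by
      intro s hs
      change Integrable (fun t : ℝ => Real.exp (-s * t)) μ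
      rw [hμ, integrable_withDensity_iff_integrable_smul₀ hg.real_toNNReal]
      refine Integrable.mono (hgi s hs) ?_ (Eventually.of_forall fun t => ?_)
      · exact (hg.real_toNNReal.smul
          (by fun_prop : Measurable fun t : ℝ => Real.exp (-s * t)).aemeasurable).aestronglyMeasurable
      · simp only [NNReal.smul_def, smul_eq_mul, Real.coe_toNNReal', norm_mul, neg_mul]
        rw [mul_comm]
        gcongr
        rw [Real.norm_eq_abs, Real.norm_eq_abs, abs_of_nonneg (le_max_right _ _)]
        exact max_le (le_abs_self _) (abs_nonneg _)
    have hmgf : (fun s : ℝ => ∫ t in Ioi (0 : ℝ), Real.exp (-(s * t)) * max (g t) 0)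
        = (ProbabilityTheory.mgf id μ) ∘ (fun s => -s) := by
      funext s
      simp only [Function.comp, ProbabilityTheory.mgf, hμ, id]
      rw [integral_withDensity_eq_integral_smul₀ hg.real_toNNReal]
      refine integral_congr_ae (Eventually.of_forall fun t => ?_)
      simp [NNReal.smul_def, mul_comm]
    rw [hmgf]
    intro s hs
    refine AnalyticAt.comp ?_ analyticAt_id.neg
    refine ProbabilityTheory.analyticAt_mgf (mem_interior_iff_mem_nhds.2 ?_)
    filter_upwards [Iio_mem_nhds (neg_lt_zero.2 hs)] with u hu
    simpa using hexp (-u) (neg_pos.2 hu)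
  have hneg : ∀ s : ℝ, 0 < s → IntegrableOn (fun t => Real.exp (-(s * t)) * (-f t)) (Ioi 0) := by
    intro s hs
    simpa using (hf s hs).neg
  have hpart : ∀ g : ℝ → ℝ, AEMeasurable g (volume.restrict (Ioi (0 : ℝ))) →
      (∀ s : ℝ, 0 < s → IntegrableOn (fun t => Real.exp (-(s * t)) * g t) (Ioi 0)) →
      ∀ s : ℝ, 0 < s → IntegrableOn (fun t => Real.exp (-(s * t)) * max (g t) 0) (Ioi 0) := by
    intro g _ hgi s hs
    refine (hgi s hs).pos_part.congr (Eventually.of_forall fun t => ?_)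
    simp [mul_max_of_nonneg _ _ (Real.exp_pos _).le]
  refine ((key f hmeas hf).sub (key _ hmeas.neg hneg)).congr isOpen_Ioi fun s hs => ?_
  simp only [Pi.sub_apply]
  rw [← integral_sub (hpart f hmeas hf s hs) (hpart _ hmeas.neg hneg s hs)]
  refine integral_congr_ae (Eventually.of_forall fun t => ?_)
  simp only [← mul_sub, Pi.neg_apply]
  congr 1
  rcases le_total 0 (f t) with h | h <;> simp [h]

open Set in
theorem integrableOn_rpow_mul_exp_neg_mul {a r : ℝ} (ha : 0 < a) (hr : 0 < r) :
    IntegrableOn (fun t : ℝ => t ^ (a - 1) * Real.exp (-(r * t))) (Ioi 0) := by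
  refine not_imp_comm.1 integral_undef ?_
  rw [Real.integral_rpow_mul_exp_neg_mul_Ioi ha hr]
  have := Real.Gamma_pos_of_pos ha
  positivity

theorem exp_neg_mul_mul_rpow_le {q s t : ℝ} (hq : 0 < q) (hs : 0 < s) (ht : 0 < t) :
    Real.exp (-(s * t)) * t ^ q ≤ (q / s) ^ q := by
  have h1 : t ≤ q / s * Real.exp (s * t / q) := by
    have h2 : s * t / q ≤ Real.exp (s * t / q) := by linarith [Real.add_one_le_exp (s * t / q)]
    calc t = q / s * (s * t / q) := by field_simp
      _ ≤ _ := by gcongr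
  calc Real.exp (-(s * t)) * t ^ q
      ≤ Real.exp (-(s * t)) * (q / s * Real.exp (s * t / q)) ^ q := by gcongr
    _ = (q / s) ^ q := by
      rw [Real.mul_rpow (by positivity) (by positivity), ← Real.exp_mul,
        div_mul_cancel₀ _ hq.ne', mul_left_comm, ← Real.exp_add]
      simp

open Set Filter in
theorem integrableOn_exp_neg_mul_mul_rpow_mul {h : ℝ → ℝ} (hh : IntegrableOn h (Ioi 0)) {q s : ℝ}
    (hq : 0 < q) (hs : 0 < s) :
    IntegrableOn (fun t => Real.exp (-(s * t)) * (t ^ q * h t)) (Ioi 0) := by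
  simp only [← mul_assoc]
  refine hh.bdd_mul (c := (q / s) ^ q)
    (by fun_prop : Measurable fun t : ℝ => Real.exp (-(s * t)) * t ^ q).aestronglyMeasurable ?_
  filter_upwards [ae_restrict_mem measurableSet_Ioi] with t ht
  have ht : 0 < t := ht
  rw [Real.norm_of_nonneg (by positivity)]
  exact exp_neg_mul_mul_rpow_le hq hs ht

open Set Filter in
/-- The Mellin transform of the Laplace transform of `t ^ q * h t`, evaluated at `q`. -/
theorem integral_rpow_mul_laplace {h : ℝ → ℝ} (hh : IntegrableOn h (Ioi 0)) {q : ℝ} (hq : 0 < q) :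
    ∫ s in Ioi (0 : ℝ), s ^ (q - 1) * ∫ t in Ioi (0 : ℝ), Real.exp (-(s * t)) * (t ^ q * h t)
      = Real.Gamma q * ∫ t in Ioi (0 : ℝ), h t := by
  have hG := Real.Gamma_pos_of_pos hq
  have hint : Integrable (Function.uncurry fun s t : ℝ =>
      s ^ (q - 1) * (Real.exp (-(s * t)) * (t ^ q * h t)))
      ((volume.restrict (Ioi (0 : ℝ))).prod (volume.restrict (Ioi (0 : ℝ)))) := by
    have hm : AEStronglyMeasurable (Function.uncurry fun s t : ℝ =>
        s ^ (q - 1) * (Real.exp (-(s * t)) * (t ^ q * h t)))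
        ((volume.restrict (Ioi (0 : ℝ))).prod (volume.restrict (Ioi (0 : ℝ)))) := by
      have h1 : AEStronglyMeasurable (fun p : ℝ × ℝ => h p.2)
          ((volume.restrict (Ioi (0 : ℝ))).prod (volume.restrict (Ioi (0 : ℝ)))) :=
        hh.aestronglyMeasurable.comp_snd
      have h2 : Measurable (fun p : ℝ × ℝ => p.1 ^ (q - 1) * (Real.exp (-(p.1 * p.2)) * p.2 ^ q)) :=
        by fun_prop
      refine (h2.aestronglyMeasurable.mul h1).congr (Eventually.of_forall fun p => ?_)
      simp [Function.uncurry, mul_assoc]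
    rw [integrable_prod_iff' hm]
    constructor
    · filter_upwards [ae_restrict_mem measurableSet_Ioi] with t ht
      refine ((integrableOn_rpow_mul_exp_neg_mul hq ht).mul_const (t ^ q * h t)).congr
        (Eventually.of_forall fun s => ?_)
      simp [Function.uncurry, mul_assoc, mul_comm s t]
    · refine (hh.norm.const_mul (Real.Gamma q)).congr ?_
      filter_upwards [ae_restrict_mem measurableSet_Ioi] with t ht
      have ht : 0 < t := ht
      have : ∫ s in Ioi (0 : ℝ), ‖Function.uncurry (fun s t : ℝ =>
          s ^ (q - 1) * (Real.exp (-(s * t)) * (t ^ q * h t))) (s, t)‖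
          = ∫ s in Ioi (0 : ℝ), (s ^ (q - 1) * Real.exp (-(t * s))) * (t ^ q * ‖h t‖) := by
        refine setIntegral_congr_fun measurableSet_Ioi fun s hs => ?_
        have hs : 0 < s := hs
        simp only [Function.uncurry, norm_mul]
        rw [Real.norm_of_nonneg (by positivity : 0 ≤ s ^ (q - 1)),
          Real.norm_of_nonneg (by positivity : 0 ≤ t ^ q), Real.norm_of_nonneg (Real.exp_pos _).le,
          mul_comm s t]
        ring
      rw [this, integral_mul_const, Real.integral_rpow_mul_exp_neg_mul_Ioi hq ht, one_div,
        Real.inv_rpow ht.le]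
      field_simp
  simp only [← integral_const_mul]
  rw [integral_integral_swap hint]
  refine setIntegral_congr_fun measurableSet_Ioi fun t ht => ?_
  have ht : 0 < t := ht
  have : ∀ s : ℝ, s ^ (q - 1) * (Real.exp (-(s * t)) * (t ^ q * h t))
      = (s ^ (q - 1) * Real.exp (-(t * s))) * (t ^ q * h t) := by
    intro s
    rw [mul_comm s t]
    ring
  simp only [this]
  rw [integral_mul_const, Real.integral_rpow_mul_exp_neg_mul_Ioi hq ht, one_div,
    Real.inv_rpow ht.le]
  field_simp

open Set Filter in
/-- The Laplace transform of `t ^ (β - 1) * E_{α,β}(-t ^ α)` at `s > 1`. -/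
theorem laplace_mittagLeffler {α β s : ℝ} (hα : 0 < α) (hβ : 0 < β) (hs : 1 < s) :
    ∫ t in Ioi (0 : ℝ), Real.exp (-(s * t)) *
      (t ^ (β - 1) * ∑' r : ℕ, (-(t ^ α)) ^ r / Real.Gamma (α * r + β))
      = s ^ (α - β) / (s ^ α + 1) := by
  have hs0 : 0 < s := one_pos.trans hs
  have hpos : ∀ r : ℕ, 0 < α * r + β := fun r => by positivity
  have hG : ∀ r : ℕ, 0 < Real.Gamma (α * r + β) := fun r => Real.Gamma_pos_of_pos (hpos r)
  set F : ℕ → ℝ → ℝ := fun r t => (-1) ^ r / Real.Gamma (α * r + β) *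
    (t ^ (α * r + β - 1) * Real.exp (-(s * t))) with hF
  have hFi : ∀ r, Integrable (F r) (volume.restrict (Ioi 0)) := fun r =>
    (integrableOn_rpow_mul_exp_neg_mul (hpos r) hs0).const_mul _
  have hpow : ∀ r : ℕ, (1 / s) ^ (α * r + β) = s ^ (-β) * (s ^ (-α)) ^ r := by
    intro r
    rw [one_div, Real.inv_rpow hs0.le, ← Real.rpow_neg hs0.le, ← Real.rpow_natCast,
      ← Real.rpow_mul hs0.le, ← Real.rpow_add hs0]
    ring_nf
  have hFv : ∀ r, ∫ t in Ioi (0 : ℝ), F r t = s ^ (-β) * (-(s ^ (-α))) ^ r := by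
    intro r
    have := (hG r).ne'
    simp only [hF]
    rw [integral_const_mul, Real.integral_rpow_mul_exp_neg_mul_Ioi (hpos r) hs0, hpow,
      neg_pow (s ^ (-α))]
    field_simp
  have hFn : ∀ r, ∫ t in Ioi (0 : ℝ), ‖F r t‖ = s ^ (-β) * (s ^ (-α)) ^ r := by
    intro r
    have h0 := (hG r).ne'
    have : ∫ t in Ioi (0 : ℝ), ‖F r t‖ = ∫ t in Ioi (0 : ℝ), 1 / Real.Gamma (α * r + β) *
        (t ^ (α * r + β - 1) * Real.exp (-(s * t))) := by
      refine setIntegral_congr_fun measurableSet_Ioi fun t ht => ?_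
      have ht : 0 < t := ht
      simp only [hF, norm_mul, norm_div, norm_pow, norm_neg, norm_one, one_pow]
      rw [Real.norm_of_nonneg (hG r).le, Real.norm_of_nonneg (Real.exp_pos _).le,
        Real.norm_of_nonneg (by positivity)]
    rw [this, integral_const_mul, Real.integral_rpow_mul_exp_neg_mul_Ioi (hpos r) hs0, hpow]
    field_simp
  have hlt : s ^ (-α) < 1 := Real.rpow_lt_one_of_one_lt_of_neg hs (neg_neg_of_pos hα)
  have h0 : 0 < s ^ (-α) := by positivity
  have hsum : HasSum _ _ := hasSum_integral_of_summable_integral_norm hFi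
    (by simpa only [hFn] using (summable_geometric_of_lt_one h0.le hlt).mul_left _)
  have hgeo : HasSum (fun r : ℕ => s ^ (-β) * (-(s ^ (-α))) ^ r)
      (s ^ (-β) * (1 - -(s ^ (-α)))⁻¹) :=
    (hasSum_geometric_of_abs_lt_one (by rwa [abs_neg, abs_of_pos h0])).mul_left _
  simp only [hFv] at hsum
  have hval := hsum.unique hgeo
  have hlhs : ∫ t in Ioi (0 : ℝ), Real.exp (-(s * t)) *
      (t ^ (β - 1) * ∑' r : ℕ, (-(t ^ α)) ^ r / Real.Gamma (α * r + β))
      = ∫ t in Ioi (0 : ℝ), ∑' r : ℕ, F r t := by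
    refine setIntegral_congr_fun measurableSet_Ioi fun t ht => ?_
    have ht : 0 < t := ht
    simp only [← tsum_mul_left]
    refine tsum_congr fun r => ?_
    have : t ^ (α * r + β - 1) = t ^ (β - 1) * (t ^ α) ^ r := by
      rw [← Real.rpow_natCast, ← Real.rpow_mul ht.le, ← Real.rpow_add ht]
      ring_nf
    simp only [hF, this, neg_pow (t ^ α)]
    ring
  rw [hlhs, hval, sub_eq_add_neg α β, Real.rpow_add hs0, Real.rpow_neg hs0.le α, sub_neg_eq_add]
  have : 0 < s ^ α := by positivity
  field_simp

/-- Gaussian-type integral of the Mittag-Leffler function: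
`∫_{−∞}^{∞} E_{α,β}(−x²) dx = π / Γ(β − α/2)`. -/
theorem stmt1 (α β : ℝ) (hα0 : 0 < α) (hα2 : α < 2) (hβ : α / 2 < β)
    (E : ℝ → ℝ) (hE : ∀ u : ℝ, E u = ∑' r : ℕ, u ^ r / Real.Gamma (α * r + β))
    (hint : Integrable (fun x : ℝ => E (-(x ^ 2)))) :
    ∫ x : ℝ, E (-(x ^ 2)) = Real.pi / Real.Gamma (β - α / 2) := by
  have hq : 0 < β - α / 2 := sub_pos.2 hβ
  have hα' : 0 < α / 2 := half_pos hα0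
  have hsq : ∀ t : ℝ, 0 < t → (t ^ (α / 2)) ^ 2 = t ^ α := by
    intro t ht
    rw [← Real.rpow_natCast, ← Real.rpow_mul ht.le]
    norm_num
  set h : ℝ → ℝ := fun t => t ^ (α / 2 - 1) * E (-((t ^ (α / 2)) ^ 2)) with hh
  have hhi : IntegrableOn h (Set.Ioi 0) :=
    (integrableOn_Ioi_comp_rpow_iff' (fun x : ℝ => E (-(x ^ 2))) hα'.ne').2 hint.integrableOn
  have hhv : α / 2 * ∫ t in Set.Ioi (0 : ℝ), h t = ∫ x in Set.Ioi (0 : ℝ), E (-(x ^ 2)) := by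
    rw [← integral_comp_rpow_Ioi_of_pos (g := fun x : ℝ => E (-(x ^ 2))) hα', ← integral_const_mul]
    simp only [hh, smul_eq_mul, mul_assoc]
  have hrat : AnalyticOnNhd ℝ (fun s : ℝ => s ^ (α - β) / (s ^ α + 1)) (Set.Ioi 0) := by
    intro s hs
    have hs : 0 < s := hs
    have hp : ∀ c : ℝ, AnalyticAt ℝ (fun s : ℝ => s ^ c) s := fun c =>
      (Real.contDiffAt_rpow_const_of_ne hs.ne').analyticAt
    exact (hp _).div ((hp _).add analyticAt_const) (by positivity)
  have hL : Set.EqOn (fun s : ℝ => ∫ t in Set.Ioi (0 : ℝ),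
      Real.exp (-(s * t)) * (t ^ (β - α / 2) * h t)) (fun s : ℝ => s ^ (α - β) / (s ^ α + 1))
      (Set.Ioi 0) := by
    refine (analyticOnNhd_laplace fun s hs =>
      integrableOn_exp_neg_mul_mul_rpow_mul hhi hq hs).eqOn_of_preconnected_of_eventuallyEq hrat
      isPreconnected_Ioi (z₀ := 2) (by simp) ?_
    filter_upwards [Ioi_mem_nhds (one_lt_two : (1 : ℝ) < 2)] with s hs
    rw [← laplace_mittagLeffler hα0 (hα'.trans hβ) hs]
    refine setIntegral_congr_fun measurableSet_Ioi fun t ht => ?_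
    have ht : 0 < t := ht
    simp only [hh, hsq t ht, ← hE]
    rw [← mul_assoc (t ^ (β - α / 2)), ← Real.rpow_add ht]
    ring_nf
  have hmain := integral_rpow_mul_laplace hhi hq
  have hleft : α / 2 * ∫ s in Set.Ioi (0 : ℝ), s ^ (β - α / 2 - 1) * ∫ t in Set.Ioi (0 : ℝ),
      Real.exp (-(s * t)) * (t ^ (β - α / 2) * h t) = Real.pi / 2 := by
    have h1 : ∫ x in Set.Ioi (0 : ℝ), (1 + x ^ 2)⁻¹ = Real.pi / 2 := by
      rw [integral_Ioi_inv_one_add_sq, Real.arctan_zero, sub_zero]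
    rw [← h1, ← integral_comp_rpow_Ioi_of_pos (g := fun x : ℝ => (1 + x ^ 2)⁻¹) hα',
      ← integral_const_mul]
    refine setIntegral_congr_fun measurableSet_Ioi fun s hs => ?_
    have hs' : 0 < s := hs
    have h2 := hL hs
    simp only at h2
    simp only [h2, hsq s hs', smul_eq_mul]
    have h3 : s ^ (α / 2 - 1) = s ^ (β - α / 2 - 1) * s ^ (α - β) := by
      rw [← Real.rpow_add hs']
      ring_nf
    rw [h3, add_comm (s ^ α)]
    ring
  have habs : ∫ x : ℝ, E (-(x ^ 2)) = 2 * ∫ x in Set.Ioi (0 : ℝ), E (-(x ^ 2)) := by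
    rw [← integral_comp_abs (f := fun x : ℝ => E (-(x ^ 2)))]
    simp only [sq_abs]
  rw [hmain] at hleft
  rw [habs, ← hhv, eq_div_iff (Real.Gamma_pos_of_pos hq).ne']
  linear_combination 2 * hleft
end

section
/- Let α be a real number with 0 < α ≤ 1 and let X > 0. For each natural number m define the fractional Poisson probability P(m) = (X^m / m!) · ∑_{n=0}^∞ ((n+m)! / Γ(α(n+m) + 1)) · (−X)^n / n!. Then the mean of this distribution is ∑_{m=0}^∞ m · P(m) = X / Γ(α + 1). -/
open Nat

theorem sum_antidiagonal_mul_pow_mul_pow_div_factorial (x y : ℝ) (N : ℕ) :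
    ∑ p ∈ Finset.HasAntidiagonal.antidiagonal N,
      (p.1 : ℝ) * (x ^ p.1 / (p.1 ! : ℝ) * ((N ! : ℝ) * (y ^ p.2 / (p.2 ! : ℝ)))) =
        N * x * (x + y) ^ (N - 1) := by
  cases N with
  | zero => simp
  | succ N =>
    rw [Finset.Nat.sum_antidiagonal_succ, Nat.add_sub_cancel, (Commute.all x y).add_pow',
      Finset.mul_sum]
    simp only [Nat.cast_zero, zero_mul, zero_add]
    refine Finset.sum_congr rfl fun p hp => ?_
    obtain rfl := Finset.HasAntidiagonal.mem_antidiagonal.mp hp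
    rw [nsmul_eq_mul, Nat.cast_add_choose ℝ, Nat.factorial_succ, Nat.factorial_succ]
    have h₁ : ((p.1 + 1 : ℕ) : ℝ) ≠ 0 := by positivity
    have h₂ : (p.1 ! : ℝ) ≠ 0 := by positivity
    have h₃ : (p.2 ! : ℝ) ≠ 0 := by positivity
    push_cast at h₁ ⊢
    field_simp
    ring

theorem rpow_mul_exp_neg_le_Gamma_add_one {s R : ℝ} (hs : 0 ≤ s) (hR : 0 ≤ R) :
    R ^ s * Real.exp (-R) ≤ Real.Gamma (s + 1) := by
  have hint := Real.GammaIntegral_convergent (s := s + 1) (by positivity)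
  have hsub : Set.Ioi R ⊆ Set.Ioi 0 := Set.Ioi_subset_Ioi hR
  rw [Real.Gamma_eq_integral (by positivity), ← integral_exp_neg_Ioi,
    ← MeasureTheory.integral_const_mul]
  refine (MeasureTheory.setIntegral_mono_on ((integrableOn_exp_neg_Ioi R).const_mul _)
    (hint.mono_set hsub) measurableSet_Ioi fun t ht => ?_).trans
    (MeasureTheory.setIntegral_mono_set hint ?_ (Filter.Eventually.of_forall hsub))
  · rw [add_sub_cancel_right, mul_comm]
    exact mul_le_mul_of_nonneg_left (Real.rpow_le_rpow hR (Set.mem_Ioi.mp ht).le hs)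
      (Real.exp_pos _).le
  · filter_upwards [MeasureTheory.ae_restrict_mem measurableSet_Ioi] with t ht
    have : (0 : ℝ) < t := ht
    show 0 ≤ _
    positivity

theorem summable_mul_pow_div_Gamma {α : ℝ} (hα : 0 < α) {r : ℝ} (hr : 0 < r) :
    Summable fun N : ℕ => (N : ℝ) * r ^ N / Real.Gamma (α * N + 1) := by
  set R : ℝ := (2 * r) ^ α⁻¹
  have hR : 0 < R := by positivity
  have hRα : R ^ α = 2 * r := Real.rpow_inv_rpow (by positivity) hα.ne'
  have hgeom := (summable_pow_mul_geometric_of_norm_lt_one 1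
    (r := (1 / 2 : ℝ)) (by norm_num)).mul_left (Real.exp R)
  refine hgeom.of_nonneg_of_le (fun N => ?_) fun N => ?_
  · have := Real.Gamma_pos_of_pos (show 0 < α * N + 1 by positivity)
    positivity
  · have hG := rpow_mul_exp_neg_le_Gamma_add_one (show 0 ≤ α * N by positivity) hR.le
    rw [Real.rpow_mul hR.le, hRα, Real.rpow_natCast] at hG
    refine (div_le_div_of_nonneg_left (by positivity) (by positivity) hG).trans_eq ?_
    rw [Real.exp_neg, mul_pow, one_div, inv_pow, pow_one]
    field_simp

/-- The terms of the double series for the mean of the fractional Poisson distribution, with `y`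
in place of `-x`. -/
noncomputable def fractionalPoissonMeanTerm (α x y : ℝ) (p : ℕ × ℕ) : ℝ :=
  (p.1 : ℝ) * (x ^ p.1 / (p.1 ! : ℝ) *
    ((((p.2 + p.1)! : ℝ) / Real.Gamma (α * ((p.2 : ℝ) + (p.1 : ℝ)) + 1)) * y ^ p.2 / (p.2 ! : ℝ)))

theorem sum_antidiagonal_fractionalPoissonMeanTerm (α x y : ℝ) (N : ℕ) :
    ∑ p ∈ Finset.HasAntidiagonal.antidiagonal N, fractionalPoissonMeanTerm α x y p =
      N * x * (x + y) ^ (N - 1) / Real.Gamma (α * N + 1) := by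
  rw [← sum_antidiagonal_mul_pow_mul_pow_div_factorial, Finset.sum_div]
  refine Finset.sum_congr rfl fun p hp => ?_
  obtain rfl := Finset.HasAntidiagonal.mem_antidiagonal.mp hp
  rw [fractionalPoissonMeanTerm, add_comm p.2 p.1, add_comm (p.2 : ℝ) (p.1 : ℝ), Nat.cast_add]
  ring

theorem norm_fractionalPoissonMeanTerm {α x : ℝ} (hα : 0 < α) (hx : 0 < x) (p : ℕ × ℕ) :
    ‖fractionalPoissonMeanTerm α x (-x) p‖ = fractionalPoissonMeanTerm α x x p := by
  have hΓ := Real.Gamma_pos_of_pos (show 0 < α * ((p.2 : ℝ) + (p.1 : ℝ)) + 1 by positivity)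
  simp only [fractionalPoissonMeanTerm, norm_mul, norm_div, norm_pow, norm_neg, Real.norm_natCast,
    Real.norm_of_nonneg hx.le, Real.norm_of_nonneg hΓ.le]

theorem summable_fractionalPoissonMeanTerm {α x : ℝ} (hα : 0 < α) (hx : 0 < x) :
    Summable (fractionalPoissonMeanTerm α x (-x)) := by
  refine Summable.of_norm ?_
  rw [← Finset.HasAntidiagonal.sigmaAntidiagonalEquivProd.summable_iff,
    summable_sigma_of_nonneg fun _ => by exact norm_nonneg _]
  refine ⟨fun _ => (hasSum_fintype _).summable, ?_⟩
  refine ((summable_mul_pow_div_Gamma hα (r := 2 * x) (by positivity)).div_const 2).congr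
    fun N => ?_
  have hsum := sum_antidiagonal_fractionalPoissonMeanTerm α x x N
  rw [← Finset.sum_coe_sort] at hsum
  simp only [Function.comp_apply, tsum_fintype, norm_fractionalPoissonMeanTerm hα hx,
    Finset.HasAntidiagonal.sigmaAntidiagonalEquivProd_apply]
  rw [hsum]
  cases N with
  | zero => simp
  | succ N =>
    rw [Nat.add_sub_cancel, pow_succ]
    ring

/-- The mean of the fractional Poisson distribution is `X / Γ(α + 1)`. -/
theorem stmt2 (α X : ℝ) (hα0 : 0 < α) (hα1 : α ≤ 1) (hX : 0 < X) (P : ℕ → ℝ)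
    (hP : ∀ m : ℕ, P m = X ^ m / (m ! : ℝ) *
      ∑' n : ℕ, (((n + m)! : ℝ) / Real.Gamma (α * ((n : ℝ) + (m : ℝ)) + 1)) * (-X) ^ n / (n ! : ℝ)) :
    ∑' m : ℕ, (m : ℝ) * P m = X / Real.Gamma (α + 1) := by
  have hs := summable_fractionalPoissonMeanTerm hα0 hX
  have hmean (m : ℕ) : (m : ℝ) * P m = ∑' n, fractionalPoissonMeanTerm α X (-X) (m, n) := by
    simp only [hP, fractionalPoissonMeanTerm, tsum_mul_left]
  have hs' := Finset.HasAntidiagonal.sigmaAntidiagonalEquivProd.summable_iff.mpr hs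
  rw [tsum_congr hmean, ← hs.tsum_prod,
    ← Finset.HasAntidiagonal.sigmaAntidiagonalEquivProd.tsum_eq]
  refine hs'.tsum_sigma.trans ?_
  have hdiag (N : ℕ) : ∑' p : Finset.HasAntidiagonal.antidiagonal N, fractionalPoissonMeanTerm α X (-X)
      (Finset.HasAntidiagonal.sigmaAntidiagonalEquivProd ⟨N, p⟩) =
        N * X * (X + -X) ^ (N - 1) / Real.Gamma (α * N + 1) := by
    rw [← sum_antidiagonal_fractionalPoissonMeanTerm, ← Finset.sum_coe_sort, tsum_fintype]
    rfl
  refine (tsum_congr hdiag).trans ?_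
  rw [tsum_eq_single 1]
  · simp
  · intro N hN
    rcases N with _ | _ | N
    · simp
    · exact absurd rfl hN
    · simp
end

section
/- Let f : ℝ → ℝ be infinitely differentiable and define the Laguerre derivative operator L on smooth functions by (L g)(x) = d/dx ( x · g′(x) ). Then for every natural number s and every x ∈ ℝ, (L^s f)(x) = d^s/dx^s ( x^s · f^{(s)}(x) ), i.e. the s-th iterate of ∂_x x ∂_x equals ∂_x^s x^s ∂_x^s. -/
theorem ContDiff.iteratedDeriv_top {g : ℝ → ℝ} (hg : ContDiff ℝ (⊤ : ℕ∞) g) (n : ℕ) :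
    ContDiff ℝ (⊤ : ℕ∞) (iteratedDeriv n g) := by
  rw [iteratedDeriv_eq_iterate]
  exact hg.iterate_deriv n

/-- Leibniz rule for iterated derivatives of a product with the identity. -/
theorem iteratedDeriv_succ_id_mul {g : ℝ → ℝ} (hg : ContDiff ℝ (⊤ : ℕ∞) g) (n : ℕ) :
    iteratedDeriv (n + 1) (fun t => t * g t) =
      fun t => t * iteratedDeriv (n + 1) g t + (n + 1) * iteratedDeriv n g t := by
  have hd (k : ℕ) (t : ℝ) : HasDerivAt (iteratedDeriv k g) (iteratedDeriv (k + 1) g t) t := by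
    rw [iteratedDeriv_succ]
    exact ((hg.iteratedDeriv_top k).differentiable (by simp) t).hasDerivAt
  induction n with
  | zero =>
    ext t
    have h := (hasDerivAt_id' t).mul (hd 0 t)
    simp only [iteratedDeriv_zero] at h
    rw [iteratedDeriv_succ, iteratedDeriv_zero]
    refine h.deriv.trans ?_
    simp
    ring
  | succ n ih =>
    ext t
    rw [iteratedDeriv_succ, ih]
    refine (((hasDerivAt_id' t).mul (hd (n + 1) t)).add
      ((hd n t).const_mul ((n : ℝ) + 1))).deriv.trans ?_
    push_cast
    ring

/-- The `s`-th iterate of the Laguerre derivative `∂_x x ∂_x` equals `∂_x^s x^s ∂_x^s`. -/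
theorem stmt5 (f : ℝ → ℝ) (hf : ContDiff ℝ (⊤ : ℕ∞) f)
    (L : (ℝ → ℝ) → (ℝ → ℝ))
    (hL : ∀ g : ℝ → ℝ, L g = deriv (fun t => t * deriv g t))
    (s : ℕ) (x : ℝ) :
    (L^[s] f) x = iteratedDeriv s (fun t => t ^ s * iteratedDeriv s f t) x := by
  induction s generalizing f with
  | zero => simp
  | succ s ih =>
    have hf' : ContDiff ℝ (⊤ : ℕ∞) (deriv f) := hf.iterate_deriv 1
    have hLf : ContDiff ℝ (⊤ : ℕ∞) (L f) := by
      rw [hL]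
      exact (contDiff_id.mul hf').iterate_deriv 1
    rw [Function.iterate_succ_apply, ih _ hLf, iteratedDeriv_succ' (n := s)]
    congr 1
    ext t
    have hd : HasDerivAt (iteratedDeriv (s + 1) f) (iteratedDeriv (s + 1) (deriv f) t) t := by
      rw [← iteratedDeriv_succ', iteratedDeriv_succ (n := s + 1)]
      exact ((hf.iteratedDeriv_top (s + 1)).differentiable (by simp) t).hasDerivAt
    rw [hL, ← iteratedDeriv_succ', iteratedDeriv_succ_id_mul hf']
    refine Eq.trans ?_ ((hasDerivAt_pow (s + 1) t).mul hd).deriv.symm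
    rw [iteratedDeriv_succ' (f := f)]
    push_cast
    ring
end

section
/- For every real number x, ∫_0^∞ e^{−t} · ( ∑_{r=0}^∞ (−1)^r (x t)^{2r} / ((2r)!)² ) dt = cos x and ∫_0^∞ e^{−t} · ( ∑_{r=0}^∞ (−1)^r (x t)^{2r+1} / ((2r+1)!)² ) dt = sin x; that is, the Borel transforms of the Laguerre cosine and sine recover the ordinary circular functions. -/
open Nat MeasureTheory

theorem integrableOn_exp_neg_mul_pow (n : ℕ) :
    IntegrableOn (fun t : ℝ => Real.exp (-t) * t ^ n) (Set.Ioi 0) := by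
  have h := Real.GammaIntegral_convergent (s := (n : ℝ) + 1) (by positivity)
  simpa only [add_sub_cancel_right, Real.rpow_natCast] using h

theorem integral_exp_neg_mul_pow (n : ℕ) :
    ∫ t in Set.Ioi (0 : ℝ), Real.exp (-t) * t ^ n = (n ! : ℝ) := by
  rw [← Real.Gamma_nat_eq_factorial, Real.Gamma_eq_integral (by positivity)]
  simp only [add_sub_cancel_right, Real.rpow_natCast]

/-- Termwise Borel summation: an absolutely convergent series is recovered from the
Laplace integral of its Borel transform. -/
theorem hasSum_integral_exp_neg_mul_tsum {c : ℕ → ℝ} (k : ℕ → ℕ) (hc : Summable c) :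
    HasSum c (∫ t in Set.Ioi (0 : ℝ),
      Real.exp (-t) * ∑' r : ℕ, c r * t ^ k r / ((k r)! : ℝ)) := by
  have hterm (a : ℝ) (n : ℕ) :
      ∫ t in Set.Ioi (0 : ℝ), a / (n ! : ℝ) * (Real.exp (-t) * t ^ n) = a := by
    rw [integral_const_mul, integral_exp_neg_mul_pow]
    field_simp
  have hnorm (r : ℕ) : ∫ t in Set.Ioi (0 : ℝ),
      ‖c r / ((k r)! : ℝ) * (Real.exp (-t) * t ^ k r)‖ = |c r| := by
    rw [← hterm |c r| (k r)]
    refine setIntegral_congr_fun measurableSet_Ioi fun t ht => ?_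
    have ht' : (0 : ℝ) ≤ t := le_of_lt ht
    simp [abs_of_nonneg ht']
  have h := hasSum_integral_of_summable_integral_norm
    (μ := volume.restrict (Set.Ioi (0 : ℝ)))
    (F := fun r t => c r / ((k r)! : ℝ) * (Real.exp (-t) * t ^ k r))
    (fun r => (integrableOn_exp_neg_mul_pow (k r)).const_mul _)
    (by simpa only [hnorm] using hc.abs)
  simp only [hterm] at h
  have hseries (t : ℝ) : Real.exp (-t) * ∑' r : ℕ, c r * t ^ k r / ((k r)! : ℝ) =
      ∑' r : ℕ, c r / ((k r)! : ℝ) * (Real.exp (-t) * t ^ k r) := by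
    rw [← tsum_mul_left]
    exact tsum_congr fun r => by ring
  simpa only [hseries] using h

/-- The Borel transforms of the Laguerre cosine and sine recover the circular functions:
`∫_0^∞ e^{−t} ₗc(xt) dt = cos x` and `∫_0^∞ e^{−t} ₗs(xt) dt = sin x`. -/
theorem stmt11 (x : ℝ) :
    (∫ t in Set.Ioi (0 : ℝ),
        Real.exp (-t) * ∑' r : ℕ, (-1) ^ r * (x * t) ^ (2 * r) / ((2 * r)! : ℝ) ^ 2)
      = Real.cos x ∧
    (∫ t in Set.Ioi (0 : ℝ),
        Real.exp (-t) * ∑' r : ℕ, (-1) ^ r * (x * t) ^ (2 * r + 1) / ((2 * r + 1)! : ℝ) ^ 2)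
      = Real.sin x := by
  have hcos := Real.hasSum_cos x
  have hsin := Real.hasSum_sin x
  constructor
  · rw [← (hasSum_integral_exp_neg_mul_tsum (fun r => 2 * r) hcos.summable).unique hcos]
    congr! 5 with t r
    ring
  · rw [← (hasSum_integral_exp_neg_mul_tsum (fun r => 2 * r + 1) hsin.summable).unique hsin]
    congr! 5 with t r
    ring
end

section
/- Let λ₊, λ₋ ∈ ℂ with λ₊ ≠ λ₋, and set C(t) = (λ₋ e^{λ₊ t} − λ₊ e^{λ₋ t})/(λ₋ − λ₊), S(t) = (e^{λ₊ t} − e^{λ₋ t})/(λ₊ − λ₋). Then for every t ∈ ℂ the fundamental trigonometric identity C(t)² + (λ₊ λ₋) S(t)² + (λ₊ + λ₋) C(t) S(t) = e^{(λ₊ + λ₋) t} holds. -/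
/-- Fundamental trigonometric identity for the second-order generalized trigonometric
functions: `C(t)² + (λ₊λ₋) S(t)² + (λ₊+λ₋) C(t) S(t) = e^{(λ₊+λ₋)t}`. -/
theorem stmt13 (lp lm : ℂ) (hne : lp ≠ lm) (t : ℂ)
    (C S : ℂ → ℂ)
    (hC : ∀ s : ℂ, C s = (lm * Complex.exp (lp * s) - lp * Complex.exp (lm * s)) / (lm - lp))
    (hS : ∀ s : ℂ, S s = (Complex.exp (lp * s) - Complex.exp (lm * s)) / (lp - lm)) :
    C t ^ 2 + (lp * lm) * S t ^ 2 + (lp + lm) * C t * S t = Complex.exp ((lp + lm) * t) := by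
  have hd : lp - lm ≠ 0 := sub_ne_zero.mpr hne
  have hp : C t + lp * S t = Complex.exp (lp * t) := by
    rw [hC, hS, ← neg_sub lp lm]
    field_simp
    ring
  have hm : C t + lm * S t = Complex.exp (lm * t) := by
    rw [hC, hS, ← neg_sub lp lm]
    field_simp
    ring
  rw [add_mul lp lm t, Complex.exp_add, ← hp, ← hm]
  ring
end

section
/- Let n ≥ 1 be a natural number and let J_k(x) = ∑_{r=0}^∞ (−1)^r (x/2)^{2r+k} / (r! (r+k)!) denote the cylindrical Bessel function of integer order k. Then for every real x ≠ 0: (a) (1/2)·( (J_n²)''(x) + (1/x)(J_n²)'(x) ) + J_n(x)² = ( J_{n−1}(x)² + J_{n+1}(x)² ) / 2, and (b) (n/x) · (J_n²)'(x) = ( J_{n−1}(x)² − J_{n+1}(x)² ) / 2, where (J_n²)' and (J_n²)'' denote the first and second derivatives of the function x ↦ J_n(x)². -/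
open Nat

/-- The cylindrical Bessel function of the first kind of integer order `k`:
`J_k(x) = ∑_{r=0}^∞ (−1)^r (x/2)^{2r+k} / (r! (r+k)!)`. -/
noncomputable def besselJ (k : ℕ) (x : ℝ) : ℝ :=
  ∑' r : ℕ, (-1) ^ r * (x / 2) ^ (2 * r + k) / ((r ! : ℝ) * ((r + k)! : ℝ))

/-- The entire function `∑ (-1)^r t^r / (r! (r+k)!)`, for which
`J_k(x) = (x/2)^k * besselAux k ((x/2)^2)`. -/
noncomputable def besselAux (k : ℕ) (t : ℝ) : ℝ :=
  ∑' r : ℕ, (-1) ^ r * t ^ r / ((r ! : ℝ) * ((r + k)! : ℝ))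

theorem besselJ_eq_besselAux (k : ℕ) (x : ℝ) :
    besselJ k x = (x / 2) ^ k * besselAux k ((x / 2) ^ 2) := by
  unfold besselJ besselAux
  rw [← tsum_mul_left]
  congr 1
  ext r
  rw [pow_add, pow_mul]
  ring

theorem abs_div_factorial_mul_factorial_le (k r : ℕ) (a : ℝ) :
    |(-1) ^ r * a / ((r ! : ℝ) * ((r + k)! : ℝ))| ≤ |a| / (r ! : ℝ) := by
  have h1 : (0 : ℝ) < r ! := by positivity
  have h2 : (1 : ℝ) ≤ (r + k)! := by exact_mod_cast Nat.one_le_iff_ne_zero.2 (factorial_ne_zero _)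
  rw [abs_div, abs_mul, abs_pow, abs_neg, abs_one, one_pow, one_mul,
    abs_of_pos (by positivity : (0 : ℝ) < r ! * (r + k)!)]
  gcongr
  nlinarith

theorem hasSum_besselAux (k : ℕ) (t : ℝ) :
    HasSum (fun r : ℕ => (-1) ^ r * t ^ r / ((r ! : ℝ) * ((r + k)! : ℝ))) (besselAux k t) := by
  refine Summable.hasSum (Summable.of_norm_bounded (Real.summable_pow_div_factorial |t|) fun r => ?_)
  rw [Real.norm_eq_abs, ← abs_pow]
  exact abs_div_factorial_mul_factorial_le k r _

theorem hasSum_besselAux_deriv (k : ℕ) (t : ℝ) :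
    HasSum (fun r : ℕ => (-1) ^ r * (r * t ^ (r - 1)) / ((r ! : ℝ) * ((r + k)! : ℝ)))
      (-besselAux (k + 1) t) := by
  rw [← hasSum_nat_add_iff' 1]
  simp only [Finset.sum_range_one, Nat.cast_zero, zero_mul, mul_zero, zero_div, sub_zero]
  convert (hasSum_besselAux (k + 1) t).neg using 2 with r
  rw [add_tsub_cancel_right, factorial_succ r, show r + 1 + k = r + (k + 1) by ring]
  have h1 : (r ! : ℝ) ≠ 0 := by positivity
  have h2 : ((r + (k + 1))! : ℝ) ≠ 0 := by positivity
  have h3 : (r + 1 : ℝ) ≠ 0 := by positivity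
  push_cast
  field_simp
  ring

theorem hasDerivAt_besselAux (k : ℕ) (t : ℝ) :
    HasDerivAt (besselAux k) (-besselAux (k + 1) t) t := by
  have hu : Summable fun r : ℕ => (r * (|t| + 1) ^ (r - 1) : ℝ) / (r ! : ℝ) := by
    rw [← summable_nat_add_iff 1]
    refine (Real.summable_pow_div_factorial (|t| + 1)).congr fun r => ?_
    rw [add_tsub_cancel_right, factorial_succ]
    push_cast
    field_simp
  rw [← (hasSum_besselAux_deriv k t).tsum_eq]
  refine hasDerivAt_tsum_of_isPreconnected (t := Metric.ball 0 (|t| + 1)) (y₀ := t)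
    (g := fun (r : ℕ) (t : ℝ) => (-1) ^ r * t ^ r / ((r ! : ℝ) * ((r + k)! : ℝ)))
    (g' := fun (r : ℕ) (t : ℝ) => (-1) ^ r * (r * t ^ (r - 1)) / ((r ! : ℝ) * ((r + k)! : ℝ)))
    hu Metric.isOpen_ball
    (convex_ball _ _).isPreconnected (fun r y _ => ?_) (fun r y hy => ?_) ?_
    (hasSum_besselAux k t).summable ?_
  · exact ((hasDerivAt_pow r y).const_mul _).div_const _
  · refine (abs_div_factorial_mul_factorial_le k r _).trans ?_
    rw [abs_mul, abs_pow, Nat.abs_cast]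
    have : |y| ≤ |t| + 1 := by simpa using (mem_ball_zero_iff.1 hy).le
    gcongr
  all_goals simp

theorem besselAux_recurrence (k : ℕ) (t : ℝ) :
    besselAux k t + t * besselAux (k + 2) t = (k + 1) * besselAux (k + 1) t := by
  have h := ((hasSum_besselAux (k + 1) t).mul_left ((k : ℝ) + 1)).add
    ((hasSum_besselAux_deriv (k + 1) t).mul_left t)
  have h' := (hasSum_besselAux k t).unique (h.congr_fun ?_)
  · rw [h']
    ring
  · intro r
    have h1 : (r ! : ℝ) ≠ 0 := by positivity
    have h2 : ((r + k)! : ℝ) ≠ 0 := by positivity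
    have h3 : (r + k + 1 : ℝ) ≠ 0 := by positivity
    have h4 : t * (r * t ^ (r - 1)) = r * t ^ r := by
      cases r with
      | zero => simp
      | succ r => rw [add_tsub_cancel_right, pow_succ]; ring
    rw [mul_div_assoc' t, mul_left_comm t, h4, ← add_assoc, factorial_succ]
    push_cast
    field_simp
    ring

theorem besselJ_recurrence (k : ℕ) (x : ℝ) :
    x * (besselJ k x + besselJ (k + 2) x) = 2 * (k + 1) * besselJ (k + 1) x := by
  simp only [besselJ_eq_besselAux]
  linear_combination 2 * (x / 2) ^ (k + 1) * besselAux_recurrence k ((x / 2) ^ 2)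

theorem hasDerivAt_besselJ (k : ℕ) {x : ℝ} (hx : x ≠ 0) :
    HasDerivAt (besselJ k) (k / x * besselJ k x - besselJ (k + 1) x) x := by
  have h2 : HasDerivAt (fun u : ℝ => u / 2) (1 / 2) x := (hasDerivAt_id x).div_const 2
  have h := (h2.pow k).mul ((hasDerivAt_besselAux k ((x / 2) ^ 2)).comp x (h2.pow 2))
  rw [show besselJ k = fun u => (u / 2) ^ k * besselAux k ((u / 2) ^ 2) from
    funext (besselJ_eq_besselAux k)]
  refine h.congr_deriv ?_
  simp only [besselJ_eq_besselAux, Function.comp_apply, Pi.pow_apply]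
  cases k with
  | zero =>
    simp
    ring
  | succ k =>
    generalize besselAux (k + 1) ((x / 2) ^ 2) = a, besselAux (k + 1 + 1) ((x / 2) ^ 2) = b
    push_cast
    field_simp
    ring

theorem hasDerivAt_besselJ_succ (k : ℕ) {x : ℝ} (hx : x ≠ 0) :
    HasDerivAt (besselJ (k + 1)) (besselJ k x - (k + 1) / x * besselJ (k + 1) x) x := by
  refine (hasDerivAt_besselJ (k + 1) hx).congr_deriv ?_
  have := besselJ_recurrence k x
  push_cast
  field_simp
  linear_combination -this

/-- Recurrences for the squares of Bessel functions:
(a) `(1/2)((J_n²)'' + (1/x)(J_n²)') + J_n² = (J_{n−1}² + J_{n+1}²)/2` and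
(b) `(n/x)(J_n²)' = (J_{n−1}² − J_{n+1}²)/2`. -/
theorem stmt14 (n : ℕ) (hn : 1 ≤ n) (x : ℝ) (hx : x ≠ 0) :
    (1 / 2) * (deriv (deriv (fun u : ℝ => besselJ n u ^ 2)) x
        + (1 / x) * deriv (fun u : ℝ => besselJ n u ^ 2) x) + besselJ n x ^ 2
      = (besselJ (n - 1) x ^ 2 + besselJ (n + 1) x ^ 2) / 2 ∧
    ((n : ℝ) / x) * deriv (fun u : ℝ => besselJ n u ^ 2) x
      = (besselJ (n - 1) x ^ 2 - besselJ (n + 1) x ^ 2) / 2 := by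
  obtain ⟨m, rfl⟩ : ∃ m, n = m + 1 := ⟨n - 1, by omega⟩
  have hd {u : ℝ} (hu : u ≠ 0) : HasDerivAt (fun u : ℝ => besselJ (m + 1) u ^ 2)
      (2 * besselJ (m + 1) u * (besselJ m u - (m + 1) / u * besselJ (m + 1) u)) u := by
    simpa using (hasDerivAt_besselJ_succ m hu).fun_pow 2
  have hdd : deriv (deriv fun u : ℝ => besselJ (m + 1) u ^ 2) x =
      2 * (besselJ m x - (m + 1) / x * besselJ (m + 1) x) ^ 2 + 2 * besselJ (m + 1) x *
        (m / x * besselJ m x - besselJ (m + 1) x + (m + 1) / x ^ 2 * besselJ (m + 1) x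
          - (m + 1) / x * (besselJ m x - (m + 1) / x * besselJ (m + 1) x)) := by
    have he : deriv (fun u : ℝ => besselJ (m + 1) u ^ 2) =ᶠ[nhds x] fun u =>
        2 * besselJ (m + 1) u * (besselJ m u - (m + 1) / u * besselJ (m + 1) u) := by
      filter_upwards [isOpen_ne.mem_nhds hx] with u hu using (hd hu).deriv
    rw [he.deriv_eq]
    have hJ := hasDerivAt_besselJ_succ m hx
    have hq : HasDerivAt (fun u : ℝ => ((m : ℝ) + 1) / u) (-(m + 1) / x ^ 2) x := by
      simpa using (hasDerivAt_const x ((m : ℝ) + 1)).fun_div (hasDerivAt_id x) hx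
    refine (((hJ.const_mul 2).fun_mul
      ((hasDerivAt_besselJ m hx).fun_sub (hq.fun_mul hJ))).congr_deriv ?_).deriv
    ring
  have hr : besselJ (m + 1 + 1) x = 2 * (m + 1) / x * besselJ (m + 1) x - besselJ m x := by
    have := besselJ_recurrence m x
    field_simp
    linear_combination this
  rw [hdd, (hd hx).deriv, hr, add_tsub_cancel_right]
  push_cast
  constructor <;> field_simp <;> ring
end
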